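/- arXiv:2303.06802 — 2 statements merged into one kernel-verified Lean document; each statement's English description precedes it below -/
import Mathlib

section
/- There exist constants 0<γ<1 and α>0 such that for every n∈ℕ there exists a function nmExt : {0,1}^n × {0,1}^n → {0,1}^m with output length m ≥ α·n that is a ((1−γ)n, (1−γ)n, 2^{−αn}) two-source non-malleable extractor. (Explicitness/efficient computability is omitted; only existence is asserted.) -/
/-- `Bits n` is the set of `n`-bit strings `{0,1}^n`. -/
abbrev Bits (n : ℕ) : Type := Fin n → Bool

/-- Statistical distance `Δ(p,q) = max_{T ⊆ S} |p(T) - q(T)|`. -/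
noncomputable def sd {α : Type*} [Fintype α] (p q : PMF α) : ℝ :=
  ⨆ T : Finset α, |∑ x ∈ T, (p x).toReal - ∑ x ∈ T, (q x).toReal|

/-- `X` has min-entropy at least `k`, i.e. `Pr[X = x] ≤ 2^{-k}` for all `x`. -/
def minEntropyGe {α : Type*} (p : PMF α) (k : ℝ) : Prop :=
  ∀ x, (p x).toReal ≤ (2 : ℝ) ^ (-k)

/-- Joint distribution of two independent random variables. -/
noncomputable def prodPMF {α β : Type*} (p : PMF α) (q : PMF β) : PMF (α × β) :=
  p.bind fun x => q.map fun y => (x, y)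

open Finset

section Deviation

variable {β : Type*} [Fintype β] [DecidableEq β]

/-- The indicator of `T`, centred over its first coordinate. -/
noncomputable def centredIndicator (T : Finset (β × β)) (a b : β) : ℝ :=
  (if (a, b) ∈ T then 1 else 0) - (∑ a', if (a', b) ∈ T then (1 : ℝ) else 0) / Fintype.card β

lemma sum_centredIndicator [Nonempty β] (T : Finset (β × β)) (b : β) :
    ∑ a, centredIndicator T a b = 0 := by
  have h : (Fintype.card β : ℝ) ≠ 0 := by exact_mod_cast Fintype.card_ne_zero
  simp only [centredIndicator, Finset.sum_sub_distrib, Finset.sum_const, card_univ, nsmul_eq_mul]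
  field_simp
  ring

lemma centredIndicator_compl [Nonempty β] (T : Finset (β × β)) (a b : β) :
    centredIndicator Tᶜ a b = -centredIndicator T a b := by
  have h : (Fintype.card β : ℝ) ≠ 0 := by exact_mod_cast Fintype.card_ne_zero
  have key : ∀ z : β × β, (if z ∈ Tᶜ then (1 : ℝ) else 0) = 1 - (if z ∈ T then 1 else 0) := by
    intro z
    by_cases hz : z ∈ T <;> simp [hz]
  simp only [centredIndicator, key, Finset.sum_sub_distrib, Finset.sum_const, card_univ,
    nsmul_eq_mul]
  field_simp
  ring

lemma centredIndicator_le [Nonempty β] (T : Finset (β × β)) (a b : β) :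
    centredIndicator T a b ≤ 1 - 1 / Fintype.card β := by
  have h : (0 : ℝ) < Fintype.card β := by exact_mod_cast Fintype.card_pos
  have h1 : (1 : ℝ) ≤ Fintype.card β := by exact_mod_cast Fintype.card_pos
  have hnn : ∀ a' ∈ (univ : Finset β), (0 : ℝ) ≤ if (a', b) ∈ T then (1 : ℝ) else 0 := by
    intro a' _
    split_ifs <;> norm_num
  unfold centredIndicator
  by_cases ha : (a, b) ∈ T
  · have hs := Finset.single_le_sum hnn (mem_univ a)
    rw [if_pos ha] at hs ⊢
    gcongr
  · have hs := div_nonneg (Finset.sum_nonneg hnn) h.le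
    have h2 : 1 / (Fintype.card β : ℝ) ≤ 1 := by rw [div_le_one h]; exact h1
    rw [if_neg ha]
    linarith

lemma abs_centredIndicator_le [Nonempty β] (T : Finset (β × β)) (a b : β) :
    |centredIndicator T a b| ≤ 1 - 1 / Fintype.card β := by
  rw [abs_le']
  refine ⟨centredIndicator_le T a b, ?_⟩
  rw [← centredIndicator_compl]
  exact centredIndicator_le _ a b

lemma sum_exp_centredIndicator_le [Nonempty β] (T : Finset (β × β)) (b : β) {l : ℝ}
    (hl0 : 0 ≤ l) (hl1 : l ≤ 1) :
    ∑ a, Real.exp (l * centredIndicator T a b) ≤ Fintype.card β * Real.exp (l ^ 2) := by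
  have habs : ∀ a, |centredIndicator T a b| ≤ 1 := fun a =>
    (abs_centredIndicator_le T a b).trans (by
      have : (0 : ℝ) ≤ 1 / Fintype.card β := by positivity
      linarith)
  have hle : ∀ a, Real.exp (l * centredIndicator T a b) ≤
      1 + l ^ 2 + l * centredIndicator T a b := by
    intro a
    have h1 : |l * centredIndicator T a b| ≤ 1 := by
      rw [abs_mul, abs_of_nonneg hl0]
      exact mul_le_one₀ hl1 (abs_nonneg _) (habs a)
    have h2 := (abs_le.mp (Real.abs_exp_sub_one_sub_id_le h1)).2
    have h3 : (l * centredIndicator T a b) ^ 2 ≤ l ^ 2 := by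
      rw [mul_pow]
      exact mul_le_of_le_one_right (sq_nonneg l) ((sq_le_one_iff_abs_le_one _).mpr (habs a))
    linarith
  calc ∑ a, Real.exp (l * centredIndicator T a b)
      ≤ ∑ a, (1 + l ^ 2 + l * centredIndicator T a b) := Finset.sum_le_sum fun a _ => hle a
    _ = Fintype.card β * (1 + l ^ 2) := by
        rw [Finset.sum_add_distrib, ← Finset.mul_sum, sum_centredIndicator]
        simp only [Finset.sum_const, card_univ, nsmul_eq_mul, mul_zero, add_zero]
    _ ≤ Fintype.card β * Real.exp (l ^ 2) := by
        gcongr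
        linarith [Real.add_one_le_exp (l ^ 2)]

end Deviation

section Random

variable {V β : Type*} [Fintype V] [DecidableEq V] [Fintype β]

/-- Averaging over all functions is invariant under resampling one value. -/
lemma sum_sum_update (G : (V → β) → ℝ) (c : V) :
    ∑ E : V → β, ∑ a, G (Function.update E c a) = Fintype.card β * ∑ E, G E := by
  have hinv : Function.Involutive
      (fun z : (V → β) × β => (Function.update z.1 c z.2, z.1 c)) := by
    rintro ⟨E, a⟩
    simp
  have h := Equiv.sum_comp hinv.toPerm (fun z : (V → β) × β => G z.1)
  simp only [Function.Involutive.coe_toPerm, Fintype.sum_prod_type] at h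
  rw [h, Finset.mul_sum]
  simp

/-- Exponential moment bound on a set of cells that tampering maps off itself. -/
lemma sum_prod_exp_le [DecidableEq β] [Nonempty β] (T : Finset (β × β)) {l : ℝ} (hl0 : 0 ≤ l)
    (hl1 : l ≤ 1) (F : V → V) (C : Finset V) (hC : ∀ c ∈ C, F c ∉ C) :
    ∑ E : V → β, ∏ c ∈ C, Real.exp (l * centredIndicator T (E c) (E (F c))) ≤
      Fintype.card (V → β) * Real.exp (l ^ 2) ^ #C := by
  induction C using Finset.induction_on with
  | empty => simp
  | insert c C hc ih =>
    have ih' := ih fun d hd => fun h => hC d (mem_insert_of_mem hd) (mem_insert_of_mem h)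
    have hcard : (0 : ℝ) < Fintype.card β := by exact_mod_cast Fintype.card_pos
    refine le_of_mul_le_mul_left ?_ hcard
    rw [← sum_sum_update _ c]
    have hFc : F c ≠ c := fun h => hC c (mem_insert_self c C) (h.symm ▸ mem_insert_self c C)
    have hrest : ∀ (E : V → β) (a : β),
        ∏ d ∈ C, Real.exp (l * centredIndicator T (Function.update E c a d)
          (Function.update E c a (F d))) =
        ∏ d ∈ C, Real.exp (l * centredIndicator T (E d) (E (F d))) := by
      intro E a
      refine Finset.prod_congr rfl fun d hd => ?_
      have h1 : d ≠ c := fun h => hc (h ▸ hd)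
      have h2 : F d ≠ c := fun h => hC d (mem_insert_of_mem hd) (h.symm ▸ mem_insert_self c C)
      rw [Function.update_of_ne h1, Function.update_of_ne h2]
    simp only [Finset.prod_insert hc, hrest, Function.update_self, Function.update_of_ne hFc,
      ← Finset.sum_mul]
    calc ∑ E : V → β, (∑ a, Real.exp (l * centredIndicator T a (E (F c)))) *
            ∏ d ∈ C, Real.exp (l * centredIndicator T (E d) (E (F d)))
        ≤ ∑ E : V → β, (Fintype.card β * Real.exp (l ^ 2)) *
            ∏ d ∈ C, Real.exp (l * centredIndicator T (E d) (E (F d))) := by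
          refine Finset.sum_le_sum fun E _ => ?_
          refine mul_le_mul_of_nonneg_right (sum_exp_centredIndicator_le T _ hl0 hl1) ?_
          exact Finset.prod_nonneg fun d _ => (Real.exp_pos _).le
      _ ≤ (Fintype.card β * Real.exp (l ^ 2)) *
            (Fintype.card (V → β) * Real.exp (l ^ 2) ^ #C) := by
          rw [← Finset.mul_sum]
          gcongr
      _ = _ := by
          rw [Finset.card_insert_of_notMem hc]
          ring

end Random

section Existence

variable {X β : Type*} [Fintype X] [DecidableEq X] [Fintype β] [DecidableEq β] [Nonempty β]

/-- The total deviation of `E` on the rectangle `S × S'` under tampering by `f` and `g`. -/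
noncomputable def rectDev (E : X × X → β) (f g : X → X) (S S' : Finset X)
    (T : Finset (β × β)) : ℝ :=
  ∑ c ∈ S ×ˢ S', centredIndicator T (E c) (E (f c.1, g c.2))

lemma exists_rectDev_le {l t : ℝ} (hl0 : 0 ≤ l) (hl1 : l ≤ 1)
    (hcount : (Fintype.card ((X → X) × (X → X) × Finset X × Finset X × Finset (β × β)) : ℝ) *
      Real.exp (l ^ 2 * (Fintype.card X : ℝ) ^ 2 - l * t) < 1) :
    ∃ E : X × X → β, ∀ (f g : X → X) (S S' : Finset X) (T : Finset (β × β)),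
      ((∀ x ∈ S, f x ∉ S) ∨ (∀ y ∈ S', g y ∉ S')) → rectDev E f g S S' T ≤ t := by
  classical
  by_contra! hbad
  let I := (X → X) × (X → X) × Finset X × Finset X × Finset (β × β)
  let good : I → Prop := fun i =>
    (∀ x ∈ i.2.2.1, i.1 x ∉ i.2.2.1) ∨ (∀ y ∈ i.2.2.2.1, i.2.1 y ∉ i.2.2.2.1)
  let D : (X × X → β) → I → ℝ := fun E i => rectDev E i.1 i.2.1 i.2.2.1 i.2.2.2.1 i.2.2.2.2
  have hone : ∀ E : X × X → β,
      1 ≤ ∑ i ∈ univ.filter good, Real.exp (l * D E i - l * t) := by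
    intro E
    obtain ⟨f, g, S, S', T, hd, ht⟩ := hbad E
    have hmem : ((f, g, S, S', T) : I) ∈ univ.filter good := by
      rw [mem_filter]
      exact ⟨mem_univ _, hd⟩
    refine le_trans ?_ (Finset.single_le_sum (fun i _ => (Real.exp_pos _).le) hmem)
    rw [Real.one_le_exp_iff]
    have : l * t ≤ l * D E (f, g, S, S', T) := mul_le_mul_of_nonneg_left ht.le hl0
    linarith
  have hmom : ∀ i ∈ univ.filter good, ∑ E : X × X → β, Real.exp (l * D E i - l * t) ≤
      Fintype.card (X × X → β) * Real.exp (l ^ 2 * (Fintype.card X : ℝ) ^ 2 - l * t) := by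
    rintro ⟨f, g, S, S', T⟩ hi
    rw [mem_filter] at hi
    have hC : ∀ c ∈ S ×ˢ S', (fun c : X × X => (f c.1, g c.2)) c ∉ S ×ˢ S' := by
      intro c hc hc'
      rw [mem_product] at hc hc'
      rcases hi.2 with h | h
      · exact h _ hc.1 hc'.1
      · exact h _ hc.2 hc'.2
    have h := sum_prod_exp_le T hl0 hl1 _ _ hC
    have hcard : (#(S ×ˢ S') : ℝ) ≤ (Fintype.card X : ℝ) ^ 2 := by
      rw [card_product, sq]
      push_cast
      gcongr <;> exact card_le_univ _
    calc ∑ E : X × X → β, Real.exp (l * rectDev E f g S S' T - l * t)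
        = (∑ E : X × X → β, ∏ c ∈ S ×ˢ S',
            Real.exp (l * centredIndicator T (E c) (E (f c.1, g c.2)))) * Real.exp (-(l * t)) := by
          rw [Finset.sum_mul]
          refine Finset.sum_congr rfl fun E _ => ?_
          rw [← Real.exp_sum, ← Finset.mul_sum, ← Real.exp_add, rectDev, sub_eq_add_neg]
      _ ≤ (Fintype.card (X × X → β) * Real.exp (l ^ 2) ^ #(S ×ˢ S')) * Real.exp (-(l * t)) := by
          gcongr
      _ = Fintype.card (X × X → β) * Real.exp (#(S ×ˢ S') * l ^ 2 - l * t) := by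
          rw [← Real.exp_nat_mul, mul_assoc, ← Real.exp_add, sub_eq_add_neg]
      _ ≤ _ := by
          rw [mul_comm (l ^ 2)]
          gcongr
  have hpos : (0 : ℝ) < Fintype.card (X × X → β) := by exact_mod_cast Fintype.card_pos
  have hle : (Fintype.card (X × X → β) : ℝ) ≤ Fintype.card (X × X → β) *
      (Fintype.card I * Real.exp (l ^ 2 * (Fintype.card X : ℝ) ^ 2 - l * t)) :=
    calc (Fintype.card (X × X → β) : ℝ) = ∑ E : X × X → β, (1 : ℝ) := by simp
      _ ≤ ∑ E : X × X → β, ∑ i ∈ univ.filter good, Real.exp (l * D E i - l * t) :=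
          Finset.sum_le_sum fun E _ => hone E
      _ = ∑ i ∈ univ.filter good, ∑ E : X × X → β, Real.exp (l * D E i - l * t) :=
          Finset.sum_comm
      _ ≤ ∑ i ∈ univ.filter good, Fintype.card (X × X → β) *
            Real.exp (l ^ 2 * (Fintype.card X : ℝ) ^ 2 - l * t) := Finset.sum_le_sum hmom
      _ = #(univ.filter good) * (Fintype.card (X × X → β) *
            Real.exp (l ^ 2 * (Fintype.card X : ℝ) ^ 2 - l * t)) := by
          rw [Finset.sum_const, nsmul_eq_mul]
      _ ≤ Fintype.card I * (Fintype.card (X × X → β) *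
            Real.exp (l ^ 2 * (Fintype.card X : ℝ) ^ 2 - l * t)) := by
          gcongr
          exact card_le_univ _
      _ = _ := by ring
  have := lt_of_le_of_lt hle (mul_lt_mul_of_pos_left hcount hpos)
  linarith

end Existence

/-- A fixed-point-free self-map of `n`-bit strings is properly coloured by `2 * n` colours. -/
lemma exists_coloring_of_no_fixed_points {n : ℕ} (f : Bits n → Bits n) (hf : ∀ x, f x ≠ x) :
    ∃ κ : Bits n → Fin n × Bool, ∀ x, κ (f x) ≠ κ x := by
  choose i hi using fun x => Function.ne_iff.mp (hf x)
  refine ⟨fun x => (i x, x (i x)), fun x h => hi x ?_⟩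
  simp only [Prod.mk.injEq] at h
  rw [← h.2, h.1]

lemma rectDev_le_of_no_fixed_points {n : ℕ} {β : Type*} [Fintype β] [DecidableEq β]
    {E : Bits n × Bits n → β} {t : ℝ}
    (hE : ∀ (f g : Bits n → Bits n) (S S' : Finset (Bits n)) (T : Finset (β × β)),
      ((∀ x ∈ S, f x ∉ S) ∨ (∀ y ∈ S', g y ∉ S')) → rectDev E f g S S' T ≤ t)
    (f g : Bits n → Bits n) (hfg : (∀ x, f x ≠ x) ∨ (∀ y, g y ≠ y))
    (S S' : Finset (Bits n)) (T : Finset (β × β)) :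
    rectDev E f g S S' T ≤ 2 * n * t := by
  have hsum : ∑ _k : Fin n × Bool, t = 2 * n * t := by
    simp [mul_comm]
  rcases hfg with h | h
  · obtain ⟨κ, hκ⟩ := exists_coloring_of_no_fixed_points f h
    rw [← hsum, rectDev, Finset.sum_product, ← Finset.sum_fiberwise S κ]
    refine Finset.sum_le_sum fun k _ => ?_
    have hk := hE f g (S.filter fun x => κ x = k) S' T (Or.inl fun x hx hfx =>
      hκ x ((mem_filter.mp hfx).2.trans (mem_filter.mp hx).2.symm))
    rwa [rectDev, Finset.sum_product] at hk
  · obtain ⟨κ, hκ⟩ := exists_coloring_of_no_fixed_points g h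
    rw [← hsum, rectDev, Finset.sum_product_right, ← Finset.sum_fiberwise S' κ]
    refine Finset.sum_le_sum fun k _ => ?_
    have hk := hE f g S (S'.filter fun x => κ x = k) T (Or.inr fun x hx hfx =>
      hκ x ((mem_filter.mp hfx).2.trans (mem_filter.mp hx).2.symm))
    rwa [rectDev, Finset.sum_product_right] at hk

/-- A linear form on a box is bounded by its value at a vertex. -/
lemma exists_sum_mul_le {X : Type*} [Fintype X] {p : X → ℝ} {B : ℝ} (hp0 : ∀ x, 0 ≤ p x)
    (hpB : ∀ x, p x ≤ B) (a : X → ℝ) : ∃ S : Finset X, ∑ x, p x * a x ≤ B * ∑ x ∈ S, a x := by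
  classical
  refine ⟨univ.filter fun x => 0 ≤ a x, ?_⟩
  rw [Finset.mul_sum, Finset.sum_filter]
  refine Finset.sum_le_sum fun x _ => ?_
  split_ifs with h
  · exact mul_le_mul_of_nonneg_right (hpB x) h
  · exact mul_nonpos_of_nonneg_of_nonpos (hp0 x) (not_le.mp h).le

/-- A bilinear form on a product of boxes is bounded by its maximum over rectangles. -/
lemma sum_sum_mul_le {X Y : Type*} [Fintype X] [Fintype Y] {p : X → ℝ} {q : Y → ℝ} {B t : ℝ}
    (hp0 : ∀ x, 0 ≤ p x) (hpB : ∀ x, p x ≤ B) (hq0 : ∀ y, 0 ≤ q y) (hqB : ∀ y, q y ≤ B)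
    (hB : 0 ≤ B) (A : X → Y → ℝ)
    (hA : ∀ (S : Finset X) (S' : Finset Y), ∑ x ∈ S, ∑ y ∈ S', A x y ≤ t) :
    ∑ x, ∑ y, p x * q y * A x y ≤ B ^ 2 * t := by
  obtain ⟨S, hS⟩ := exists_sum_mul_le hp0 hpB fun x => ∑ y, q y * A x y
  obtain ⟨S', hS'⟩ := exists_sum_mul_le hq0 hqB fun y => ∑ x ∈ S, A x y
  calc ∑ x, ∑ y, p x * q y * A x y = ∑ x, p x * ∑ y, q y * A x y := by
        simp only [Finset.mul_sum, mul_assoc]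
    _ ≤ B * ∑ x ∈ S, ∑ y, q y * A x y := hS
    _ = B * ∑ y, q y * ∑ x ∈ S, A x y := by
        rw [Finset.sum_comm]
        simp only [Finset.mul_sum]
    _ ≤ B * (B * ∑ y ∈ S', ∑ x ∈ S, A x y) := mul_le_mul_of_nonneg_left hS' hB
    _ ≤ B * (B * t) := by
        rw [Finset.sum_comm]
        gcongr
        exact hA S S'
    _ = B ^ 2 * t := by ring

section Distributions

variable {α β : Type*}

lemma PMF.sum_toReal_eq_one [Fintype α] (p : PMF α) : ∑ x, (p x).toReal = 1 := by
  have h := p.tsum_coe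
  rw [tsum_fintype] at h
  rw [← ENNReal.toReal_sum fun x _ => p.apply_ne_top x, h, ENNReal.toReal_one]

lemma PMF.toReal_map_apply [Fintype α] [DecidableEq β] (p : PMF α) (h : α → β) (z : β) :
    ((p.map h) z).toReal = ∑ a, (p a).toReal * if h a = z then 1 else 0 := by
  rw [PMF.map_apply, tsum_fintype, ENNReal.toReal_sum]
  · refine Finset.sum_congr rfl fun a _ => ?_
    by_cases hz : h a = z
    · simp [hz]
    · simp [hz, Ne.symm hz]
  · intro a _
    split_ifs
    · exact p.apply_ne_top a
    · exact ENNReal.zero_ne_top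

lemma toReal_prodPMF_apply [Fintype α] [Fintype β] (p : PMF α) (q : PMF β) (x : α) (y : β) :
    (prodPMF p q (x, y)).toReal = (p x).toReal * (q y).toReal := by
  classical
  rw [prodPMF, PMF.bind_apply, tsum_fintype, ENNReal.toReal_sum]
  · simp only [ENNReal.toReal_mul, PMF.toReal_map_apply, Prod.mk.injEq]
    rw [Finset.sum_eq_single x]
    · simp
    · intro x' _ hx'
      simp [hx']
    · simp
  · intro x' _
    exact ENNReal.mul_ne_top (p.apply_ne_top _) (PMF.apply_ne_top _ _)

/-- The gap between the two distributions on a test `T` is an expected centred indicator. -/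
lemma sum_sub_sum_eq_centredIndicator {X : Type*} [Fintype X] [Fintype β] [DecidableEq β]
    [Nonempty β] (pX pY : PMF X) (A A' : X × X → β) (T : Finset (β × β)) :
    ∑ z ∈ T, (((prodPMF pX pY).map fun xy => (A xy, A' xy)) z).toReal -
      ∑ z ∈ T, (prodPMF (PMF.uniformOfFintype β) ((prodPMF pX pY).map A') z).toReal =
    ∑ x, ∑ y, (pX x).toReal * (pY y).toReal * centredIndicator T (A (x, y)) (A' (x, y)) := by
  have h1 : ∑ z ∈ T, (((prodPMF pX pY).map fun xy => (A xy, A' xy)) z).toReal =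
      ∑ c : X × X, (prodPMF pX pY c).toReal * if (A c, A' c) ∈ T then 1 else 0 := by
    simp only [PMF.toReal_map_apply]
    rw [Finset.sum_comm]
    simp only [← Finset.mul_sum, Finset.sum_ite_eq]
  have h2 : ∑ z ∈ T, (prodPMF (PMF.uniformOfFintype β) ((prodPMF pX pY).map A') z).toReal =
      ∑ c : X × X, (prodPMF pX pY c).toReal *
        ((∑ a', if (a', A' c) ∈ T then (1 : ℝ) else 0) / Fintype.card β) := by
    have hT : ∀ F : β × β → ℝ, ∑ z ∈ T, F z = ∑ a, ∑ b, if (a, b) ∈ T then F (a, b) else 0 := by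
      intro F
      rw [← Fintype.sum_prod_type' fun a b => if (a, b) ∈ T then F (a, b) else 0]
      simp
    rw [hT]
    simp only [toReal_prodPMF_apply, PMF.toReal_map_apply, PMF.uniformOfFintype_apply,
      ENNReal.toReal_inv, ENNReal.toReal_natCast]
    have hb : ∀ a, (∑ b, if (a, b) ∈ T then (Fintype.card β : ℝ)⁻¹ *
        ∑ c : X × X, (prodPMF pX pY c).toReal * (if A' c = b then 1 else 0) else 0) =
        ∑ c : X × X, (prodPMF pX pY c).toReal *
          ((if (a, A' c) ∈ T then 1 else 0) / Fintype.card β) := by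
      intro a
      calc _ = ∑ b, ∑ c : X × X, if A' c = b then
              (prodPMF pX pY c).toReal * ((if (a, b) ∈ T then 1 else 0) / Fintype.card β) else 0 := by
            refine Finset.sum_congr rfl fun b _ => ?_
            by_cases hab : (a, b) ∈ T
            · simp only [if_pos hab, Finset.mul_sum]
              refine Finset.sum_congr rfl fun c _ => ?_
              split_ifs <;> ring
            · simp [hab]
        _ = _ := by
            rw [Finset.sum_comm]
            simp
    simp only [hb]
    rw [Finset.sum_comm]
    simp only [← Finset.mul_sum, Finset.sum_div]
  rw [h1, h2, ← Finset.sum_sub_distrib, Fintype.sum_prod_type]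
  simp only [toReal_prodPMF_apply, centredIndicator, ← mul_sub]

end Distributions

lemma four_mul_le_two_rpow {n : ℕ} (hn : 80 ≤ n) : (4 * n : ℝ) ≤ 2 ^ ((n : ℝ) / 8) := by
  have hq : ∀ q : ℕ, 10 ≤ q → 32 * q + 32 ≤ 2 ^ q := by
    intro q hq
    induction q, hq using Nat.le_induction with
    | base => norm_num
    | succ q hq ih =>
      rw [pow_succ]
      omega
  have h1 : 4 * n ≤ 2 ^ (n / 8) := le_trans (by omega) (hq (n / 8) (by omega))
  have h2 : ((n / 8 : ℕ) : ℝ) ≤ (n : ℝ) / 8 := by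
    simpa using Nat.cast_div_le (α := ℝ) (m := n) (n := 8)
  calc (4 * n : ℝ) ≤ (2 : ℝ) ^ (n / 8) := by exact_mod_cast h1
    _ = (2 : ℝ) ^ ((n / 8 : ℕ) : ℝ) := (Real.rpow_natCast _ _).symm
    _ ≤ 2 ^ ((n : ℝ) / 8) := Real.rpow_le_rpow_of_exponent_le one_le_two h2

lemma card_tampering_le (n : ℕ) :
    Fintype.card ((Bits n → Bits n) × (Bits n → Bits n) × Finset (Bits n) × Finset (Bits n) ×
      Finset (Bits (n / 4) × Bits (n / 4))) ≤ 2 ^ ((2 * n + 3) * 2 ^ n) := by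
  have hM : 2 ^ (n / 4) * 2 ^ (n / 4) ≤ 2 ^ n := by
    rw [← pow_add]
    exact Nat.pow_le_pow_right two_pos (by omega)
  simp only [Fintype.card_prod, Fintype.card_fun, Fintype.card_finset, Fintype.card_fin,
    Fintype.card_bool]
  rw [← pow_mul, ← pow_add, ← pow_add, ← pow_add, ← pow_add]
  refine Nat.pow_le_pow_right two_pos ?_
  linarith

lemma exists_rectDev_le_bits {n : ℕ} (hn : 80 ≤ n) :
    ∃ E : Bits n × Bits n → Bits (n / 4), ∀ (f g : Bits n → Bits n) (S S' : Finset (Bits n))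
      (T : Finset (Bits (n / 4) × Bits (n / 4))),
      ((∀ x ∈ S, f x ∉ S) ∨ (∀ y ∈ S', g y ∉ S')) →
        rectDev E f g S S' T ≤ 2 * (2 : ℝ) ^ (13 / 8 * (n : ℝ)) := by
  have hn0 : (0 : ℝ) ≤ n := n.cast_nonneg
  refine exists_rectDev_le (l := (2 : ℝ) ^ (-(3 / 8 * (n : ℝ)))) (by positivity) ?_ ?_
  · exact Real.rpow_le_one_of_one_le_of_nonpos one_le_two (by linarith)
  have hcardX : (Fintype.card (Bits n) : ℝ) = (2 : ℝ) ^ (n : ℝ) := by simp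
  have hexp : ((2 : ℝ) ^ (-(3 / 8 * (n : ℝ)))) ^ 2 * (Fintype.card (Bits n) : ℝ) ^ 2 -
      (2 : ℝ) ^ (-(3 / 8 * (n : ℝ))) * (2 * (2 : ℝ) ^ (13 / 8 * (n : ℝ))) =
      -((2 : ℝ) ^ n * ((2 : ℝ) ^ ((n : ℝ) / 8)) ^ 2) := by
    rw [hcardX, ← Real.rpow_natCast 2 n]
    simp only [← Real.rpow_natCast, ← Real.rpow_mul zero_le_two]
    rw [mul_left_comm, ← Real.rpow_add two_pos, ← Real.rpow_add two_pos, ← Real.rpow_add two_pos]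
    ring_nf
  rw [hexp, Real.exp_neg, ← div_eq_mul_inv, div_lt_one (Real.exp_pos _)]
  have h4 := four_mul_le_two_rpow hn
  have hn80 : (80 : ℝ) ≤ n := by exact_mod_cast hn
  have hw : (2 * n + 3 : ℝ) ≤ ((2 : ℝ) ^ ((n : ℝ) / 8)) ^ 2 := by nlinarith
  calc (Fintype.card _ : ℝ) ≤ (2 : ℝ) ^ ((2 * n + 3) * 2 ^ n) := by
        exact_mod_cast card_tampering_le n
    _ < Real.exp 1 ^ ((2 * n + 3) * 2 ^ n) := by
        refine pow_lt_pow_left₀ ?_ zero_le_two (by positivity)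
        linarith [Real.exp_one_gt_d9]
    _ = Real.exp ((2 * n + 3) * 2 ^ n) := by
        rw [← Real.exp_nat_mul]
        push_cast
        rw [mul_one]
    _ ≤ _ := by
        rw [Real.exp_le_exp, mul_comm]
        gcongr

lemma sd_le {α : Type*} [Fintype α] {p q : PMF α} {ε : ℝ}
    (h : ∀ T : Finset α, |∑ x ∈ T, (p x).toReal - ∑ x ∈ T, (q x).toReal| ≤ ε) : sd p q ≤ ε :=
  ciSup_le h

lemma sum_sum_mul_centredIndicator_le_half {X β : Type*} [Fintype X] [Fintype β] [DecidableEq β]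
    [Nonempty β] (hβ : Fintype.card β = 2) (pX pY : PMF X) (A A' : X × X → β)
    (T : Finset (β × β)) :
    ∑ x, ∑ y, (pX x).toReal * (pY y).toReal * centredIndicator T (A (x, y)) (A' (x, y)) ≤
      1 / 2 := by
  calc ∑ x, ∑ y, (pX x).toReal * (pY y).toReal * centredIndicator T (A (x, y)) (A' (x, y))
      ≤ ∑ x, ∑ y, (pX x).toReal * (pY y).toReal * (1 / 2) := by
        gcongr
        refine (centredIndicator_le T _ _).trans ?_
        rw [hβ]
        norm_num
    _ = 1 / 2 := by
        simp only [← Finset.sum_mul, ← Finset.mul_sum, PMF.sum_toReal_eq_one, mul_one, one_mul]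

/-- It suffices to bound the expected centred indicator of every test from above. -/
lemma sd_le_of_sum_centredIndicator_le {n m : ℕ} (E : Bits n × Bits n → Bits m)
    (pX pY : PMF (Bits n)) (f g : Bits n → Bits n) (ε : ℝ)
    (h : ∀ T, ∑ x, ∑ y, (pX x).toReal * (pY y).toReal *
      centredIndicator T (E (x, y)) (E (f x, g y)) ≤ ε) :
    sd ((prodPMF pX pY).map fun xy => (E (xy.1, xy.2), E (f xy.1, g xy.2)))
      (prodPMF (PMF.uniformOfFintype (Bits m))
        ((prodPMF pX pY).map fun xy => E (f xy.1, g xy.2))) ≤ ε := by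
  refine sd_le fun T => ?_
  rw [sum_sub_sum_eq_centredIndicator, abs_le']
  refine ⟨h T, ?_⟩
  simpa only [centredIndicator_compl, mul_neg, Finset.sum_neg_distrib] using h Tᶜ

/-- There exist constants `0 < γ < 1` and `α > 0` such that for every `n` there is a
`((1-γ)n, (1-γ)n, 2^{-αn})` two-source non-malleable extractor with output length
`m ≥ α n`: for all independent sources `X`, `Y` with min-entropy `≥ (1-γ)n` and all
tampering functions `f`, `g` such that `f` or `g` has no fixed points,
`Δ((nmExt(X,Y), nmExt(f(X),g(Y))), (U_m, nmExt(f(X),g(Y)))) ≤ 2^{-αn}`. -/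
theorem stmt_9 :
    ∃ γ : ℝ, 0 < γ ∧ γ < 1 ∧
      ∃ α : ℝ, α > 0 ∧
        ∀ n : ℕ,
          ∃ m : ℕ, (m : ℝ) ≥ α * n ∧
            ∃ nmExt : Bits n → Bits n → Bits m,
              ∀ pX pY : PMF (Bits n),
                minEntropyGe pX ((1 - γ) * n) → minEntropyGe pY ((1 - γ) * n) →
                ∀ f g : Bits n → Bits n,
                  ((∀ x, f x ≠ x) ∨ (∀ y, g y ≠ y)) →
                  sd ((prodPMF pX pY).map
                        fun xy => (nmExt xy.1 xy.2, nmExt (f xy.1) (g xy.2)))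
                     (prodPMF (PMF.uniformOfFintype (Bits m))
                       ((prodPMF pX pY).map fun xy => nmExt (f xy.1) (g xy.2)))
                    ≤ (2 : ℝ) ^ (-(α * n)) := by
  refine ⟨1 / 16, by norm_num, by norm_num, 1 / 80, by norm_num, fun n => ?_⟩
  have hn0 : (0 : ℝ) ≤ n := n.cast_nonneg
  rcases lt_or_ge n 80 with hn | hn
  · have hn' : (n : ℝ) < 80 := by exact_mod_cast hn
    refine ⟨1, by push_cast; linarith, fun _ _ _ => false, fun pX pY _ _ f g _ => ?_⟩
    refine (sd_le_of_sum_centredIndicator_le (fun _ _ => false) pX pY f g (1 / 2) fun T =>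
      sum_sum_mul_centredIndicator_le_half (by simp) pX pY (fun _ _ => false)
        (fun _ _ => false) T).trans ?_
    rw [one_div, ← Real.rpow_neg_one]
    exact Real.rpow_le_rpow_of_exponent_le one_le_two (by linarith)
  · obtain ⟨E, hE⟩ := exists_rectDev_le_bits hn
    refine ⟨n / 4, ?_, fun x y => E (x, y), fun pX pY hX hY f g hfg => ?_⟩
    · have h : n ≤ 80 * (n / 4) := by omega
      have h' : (n : ℝ) ≤ 80 * (n / 4 : ℕ) := by exact_mod_cast h
      linarith
    refine sd_le_of_sum_centredIndicator_le E pX pY f g _ fun T => ?_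
    refine (sum_sum_mul_le (fun _ => ENNReal.toReal_nonneg) hX (fun _ => ENNReal.toReal_nonneg) hY
      (by positivity) (fun x y => centredIndicator T (E (x, y)) (E (f x, g y)))
      fun S S' => ?_).trans
      (b := ((2 : ℝ) ^ (-((1 - 1 / 16) * (n : ℝ)))) ^ 2 *
        (2 * n * (2 * (2 : ℝ) ^ (13 / 8 * (n : ℝ))))) ?_
    · have h := rectDev_le_of_no_fixed_points hE f g hfg S S' T
      rwa [rectDev, Finset.sum_product] at h
    · calc ((2 : ℝ) ^ (-((1 - 1 / 16) * (n : ℝ)))) ^ 2 *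
            (2 * n * (2 * (2 : ℝ) ^ (13 / 8 * (n : ℝ))))
          = 4 * n * (2 : ℝ) ^ (-((n : ℝ) / 4)) := by
            rw [← Real.rpow_natCast, ← Real.rpow_mul zero_le_two]
            have h : -((n : ℝ) / 4) =
                -((1 - 1 / 16) * (n : ℝ)) * (2 : ℕ) + 13 / 8 * (n : ℝ) := by
              push_cast
              ring
            rw [h, Real.rpow_add two_pos]
            ring
        _ ≤ (2 : ℝ) ^ ((n : ℝ) / 8) * (2 : ℝ) ^ (-((n : ℝ) / 4)) := by
            gcongr
            exact four_mul_le_two_rpow hn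
        _ = (2 : ℝ) ^ (-((n : ℝ) / 8)) := by
            rw [← Real.rpow_add two_pos]
            ring_nf
        _ ≤ _ := Real.rpow_le_rpow_of_exponent_le one_le_two (by linarith)
end

section
/- There exist constants 0<γ<1 and α>0 such that for every n∈ℕ there exists a function anmExt : {0,1}^n → {0,1}^m with output length m ≥ α·n that is a ((1−γ)n, 2^{−αn}) affine non-malleable extractor. (Explicitness/efficient computability is omitted; only existence is asserted.) -/
/-- `{0,1}^n` identified with the vector space `F₂ⁿ`. -/
abbrev BV (n : ℕ) : Type := Fin n → ZMod 2

/-- The uniform distribution over the affine subspace (coset) `v + W`. -/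
noncomputable def uniformCoset {V : Type*} [AddCommGroup V] [Module (ZMod 2) V] [Finite V]
    (W : Submodule (ZMod 2) V) (v : V) : PMF V :=
  letI : Fintype W := Fintype.ofFinite W
  letI : Nonempty W := ⟨0⟩
  PMF.map (fun w => v + (w : V)) (PMF.uniformOfFintype W)

/-- Resampling one coordinate of a uniformly random function does not change averages. -/
lemma sum_sum_update_s10 {V U : Type*} [Fintype V] [DecidableEq V] [Fintype U] (x₀ : V)
    (F : (V → U) → ℝ) :
    ∑ g : V → U, ∑ u : U, F (Function.update g x₀ u) = Fintype.card U * ∑ g : V → U, F g := by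
  let e := Equiv.funSplitAt x₀ U
  have key : ∀ G : (V → U) → ℝ, ∑ g, G g = ∑ p : U × ({j // j ≠ x₀} → U), G (e.symm p) :=
    fun G => (Equiv.sum_comp e.symm G).symm
  have hupd : ∀ (p : U × ({j // j ≠ x₀} → U)) (u : U),
      Function.update (e.symm p) x₀ u = e.symm (u, p.2) := by
    intro p u
    ext j
    by_cases hj : j = x₀
    · subst hj; simp [e, Equiv.funSplitAt, Equiv.piSplitAt]
    · simp [e, Equiv.funSplitAt, Equiv.piSplitAt, hj]
  rw [key, key F, Fintype.sum_prod_type, Fintype.sum_prod_type]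
  simp only [hupd]
  rw [Finset.sum_const, nsmul_eq_mul, Finset.card_univ, Finset.sum_comm]

/-- If `f` maps `C` outside itself, the factors `φ (g x) (g (f x))`, `x ∈ C`, behave like
independent ones for a uniformly random `g`. -/
lemma sum_prod_le_of_forall_notMem {V U : Type*} [Fintype V] [DecidableEq V] [Fintype U]
    (f : V → V) (φ : U → U → ℝ) (hφ : ∀ u w, 0 ≤ φ u w) {B : ℝ} (hB : 0 ≤ B)
    (hsum : ∀ w, ∑ u, φ u w ≤ B * Fintype.card U) [Nonempty U] (C : Finset V)
    (hC : ∀ x ∈ C, f x ∉ C) :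
    ∑ g : V → U, ∏ x ∈ C, φ (g x) (g (f x)) ≤ B ^ C.card * Fintype.card (V → U) := by
  induction C using Finset.induction_on with
  | empty => simp
  | insert x₀ C hx₀ ih =>
    have hU : (0 : ℝ) < Fintype.card U := by exact_mod_cast Fintype.card_pos
    have ih' := ih fun x hx h =>
      hC x (Finset.mem_insert_of_mem hx) (Finset.mem_insert_of_mem h)
    have hf₀ : f x₀ ≠ x₀ := fun h =>
      hC x₀ (Finset.mem_insert_self _ _) (by rw [h]; exact Finset.mem_insert_self _ _)
    have hf : ∀ x ∈ C, f x ≠ x₀ := fun x hx h =>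
      hC x (Finset.mem_insert_of_mem hx) (by rw [h]; exact Finset.mem_insert_self _ _)
    have hstep : ∀ g : V → U,
        ∑ u, ∏ x ∈ insert x₀ C,
          φ (Function.update g x₀ u x) (Function.update g x₀ u (f x))
          ≤ (B * Fintype.card U) * ∏ x ∈ C, φ (g x) (g (f x)) := by
      intro g
      have hprod : ∀ u, ∏ x ∈ insert x₀ C,
          φ (Function.update g x₀ u x) (Function.update g x₀ u (f x))
          = φ u (g (f x₀)) * ∏ x ∈ C, φ (g x) (g (f x)) := by
        intro u
        rw [Finset.prod_insert hx₀, Function.update_self, Function.update_of_ne hf₀]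
        congr 1
        refine Finset.prod_congr rfl fun x hx => ?_
        rw [Function.update_of_ne (hf x hx), Function.update_of_ne]
        rintro rfl
        exact hx₀ hx
      simp only [hprod]
      rw [← Finset.sum_mul]
      exact mul_le_mul_of_nonneg_right (hsum _) (Finset.prod_nonneg fun x _ => hφ _ _)
    have h := Finset.sum_le_sum fun g (_ : g ∈ (Finset.univ : Finset (V → U))) => hstep g
    rw [sum_sum_update_s10 x₀ fun g => ∏ x ∈ insert x₀ C, φ (g x) (g (f x)),
      ← Finset.mul_sum] at h
    rw [Finset.card_insert_of_notMem hx₀, pow_succ]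
    have h2 : (Fintype.card U : ℝ) * ∑ g : V → U, ∏ x ∈ insert x₀ C, φ (g x) (g (f x))
        ≤ Fintype.card U * (B * ∑ g : V → U, ∏ x ∈ C, φ (g x) (g (f x))) := by
      linarith
    have h3 := le_of_mul_le_mul_left h2 hU
    have h4 := mul_le_mul_of_nonneg_left ih' hB
    linarith

/-- Hoeffding's lemma for the uniform distribution on a finite type. -/
lemma sum_exp_le_of_sum_eq_zero {U : Type*} [Fintype U] (h : U → ℝ) (hb : ∀ u, |h u| ≤ 1)
    (h0 : ∑ u, h u = 0) (t : ℝ) :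
    ∑ u, Real.exp (t * h u) ≤ Real.exp (t ^ 2 / 2) * Fintype.card U := by
  have hconv : ∀ u, Real.exp (t * h u) ≤ Real.cosh t + h u * Real.sinh t := by
    intro u
    obtain ⟨h1, h2⟩ := abs_le.mp (hb u)
    have := convexOn_exp.2 (Set.mem_univ t) (Set.mem_univ (-t))
      (by linarith : (0 : ℝ) ≤ (1 + h u) / 2) (by linarith : (0 : ℝ) ≤ (1 - h u) / 2) (by ring)
    simp only [smul_eq_mul] at this
    rw [Real.cosh_eq, Real.sinh_eq]
    calc Real.exp (t * h u) = Real.exp ((1 + h u) / 2 * t + (1 - h u) / 2 * -t) := by ring_nf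
      _ ≤ _ := this
      _ = _ := by ring
  calc ∑ u, Real.exp (t * h u) ≤ ∑ u, (Real.cosh t + h u * Real.sinh t) :=
        Finset.sum_le_sum fun u _ => hconv u
    _ = Real.cosh t * Fintype.card U := by
        rw [Finset.sum_add_distrib, ← Finset.sum_mul, h0]
        simp [mul_comm]
    _ ≤ _ := by
        gcongr
        exact Real.cosh_le_exp_half_sq t

/-- The bias of the test `T` at `(u, w)`, centred over a uniform first coordinate. -/
noncomputable def testBias {U : Type*} [Fintype U] [DecidableEq U] (T : Finset (U × U))
    (u w : U) : ℝ :=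
  (if (u, w) ∈ T then 1 else 0) - (∑ u', if (u', w) ∈ T then (1 : ℝ) else 0) / Fintype.card U

lemma abs_testBias_le {U : Type*} [Fintype U] [DecidableEq U] (T : Finset (U × U)) (u w : U) :
    |testBias T u w| ≤ 1 := by
  have hU : (0 : ℝ) < Fintype.card U := by exact_mod_cast Fintype.card_pos_iff.mpr ⟨u⟩
  have h0 : 0 ≤ (∑ u', if (u', w) ∈ T then (1 : ℝ) else 0) / Fintype.card U :=
    div_nonneg (Finset.sum_nonneg fun _ _ => by split_ifs <;> norm_num) hU.le
  have h1 : (∑ u', if (u', w) ∈ T then (1 : ℝ) else 0) / Fintype.card U ≤ 1 := by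
    rw [div_le_one hU]
    calc (∑ u', if (u', w) ∈ T then (1 : ℝ) else 0) ≤ ∑ _u' : U, (1 : ℝ) :=
          Finset.sum_le_sum fun _ _ => by split_ifs <;> norm_num
      _ = _ := by simp
  unfold testBias
  rw [abs_le]
  split_ifs <;> constructor <;> linarith

lemma sum_testBias {U : Type*} [Fintype U] [DecidableEq U] (T : Finset (U × U)) (w : U) :
    ∑ u, testBias T u w = 0 := by
  unfold testBias
  rcases isEmpty_or_nonempty U with h | h
  · simp
  have hU : (Fintype.card U : ℝ) ≠ 0 := by exact_mod_cast Fintype.card_ne_zero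
  rw [Finset.sum_sub_distrib, Finset.sum_const, nsmul_eq_mul, Finset.card_univ,
    mul_div_cancel₀ _ hU, sub_self]

lemma testBias_compl {U : Type*} [Fintype U] [DecidableEq U] (T : Finset (U × U)) (u w : U) :
    testBias Tᶜ u w = -testBias T u w := by
  have hU : (Fintype.card U : ℝ) ≠ 0 := by
    exact_mod_cast (Fintype.card_pos_iff.mpr ⟨u⟩).ne'
  have hc : ∀ a : U × U, (if a ∈ Tᶜ then (1 : ℝ) else 0) = 1 - if a ∈ T then 1 else 0 := by
    intro a
    by_cases ha : a ∈ T <;> simp [ha]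
  unfold testBias
  simp only [hc, Finset.sum_sub_distrib, Finset.sum_const, nsmul_eq_mul, Finset.card_univ]
  field_simp
  ring

/-- A single function simultaneously has small total bias on every set of a finite family, each
moved off itself by the corresponding tampering map. -/
lemma exists_forall_sum_testBias_le {V U ι : Type*} [Fintype V] [DecidableEq V] [Fintype U]
    [DecidableEq U] [Nonempty U] [Fintype ι] (C : ι → Finset V) (f : ι → V → V)
    (hC : ∀ i, ∀ x ∈ C i, f i x ∉ C i) {t : ℝ} (ht : 0 < t) :
    ∃ g : V → U, ∀ i (T : Finset (U × U)),
      ∑ x ∈ C i, testBias T (g x) (g (f i x)) ≤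
        Real.log (Fintype.card ι * Fintype.card (Finset (U × U))) / t
          + t * (C i).card / 2 := by
  let X : ι × Finset (U × U) → (V → U) → ℝ := fun p g =>
    Real.exp (t * ∑ x ∈ C p.1, testBias p.2 (g x) (g (f p.1 x)) - t ^ 2 / 2 * (C p.1).card)
  have hX : ∀ p, ∑ g, X p g ≤ Fintype.card (V → U) := by
    intro p
    have h := sum_prod_le_of_forall_notMem (f p.1)
      (fun u w => Real.exp (t * testBias p.2 u w)) (fun _ _ => (Real.exp_pos _).le)
      (Real.exp_pos (t ^ 2 / 2)).le
      (fun w => sum_exp_le_of_sum_eq_zero _ (fun u => abs_testBias_le p.2 u w)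
        (sum_testBias p.2 w) t) (C p.1) (hC p.1)
    rw [← Real.exp_nat_mul] at h
    simp only [← Real.exp_sum, ← Finset.mul_sum] at h
    simp only [X, Real.exp_sub]
    rw [← Finset.sum_div, div_le_iff₀ (Real.exp_pos _), mul_comm (t ^ 2 / 2)]
    linarith
  have htot : ∑ g : V → U, ∑ p, X p g
      ≤ ∑ _g : V → U, (Fintype.card (ι × Finset (U × U)) : ℝ) := by
    rw [Finset.sum_comm]
    calc ∑ p, ∑ g, X p g ≤ ∑ _p : ι × Finset (U × U), (Fintype.card (V → U) : ℝ) :=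
          Finset.sum_le_sum fun p _ => hX p
      _ = _ := by simp only [Finset.sum_const, nsmul_eq_mul, Finset.card_univ]; ring
  obtain ⟨g, -, hg⟩ := Finset.exists_le_of_sum_le Finset.univ_nonempty htot
  refine ⟨g, fun i T => ?_⟩
  have h1 : X (i, T) g ≤ Fintype.card (ι × Finset (U × U)) :=
    (Finset.single_le_sum (f := fun p => X p g) (fun p _ => (Real.exp_pos _).le)
      (Finset.mem_univ (i, T))).trans hg
  have h2 := Real.log_le_log (Real.exp_pos _) h1
  rw [Real.log_exp, Fintype.card_prod, Nat.cast_mul] at h2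
  rw [← sub_le_iff_le_add, le_div_iff₀ ht]
  dsimp only at h2
  nlinarith [h2]

lemma toReal_map_uniformCoset {n : ℕ} {β : Type*} [DecidableEq β]
    (W : Submodule (ZMod 2) (BV n)) (v₀ : BV n) [Fintype W] (F : BV n → β) (y : β) :
    ((uniformCoset W v₀).map F y).toReal
      = (∑ w : W, if F (v₀ + w) = y then (1 : ℝ) else 0) / Fintype.card W := by
  have : Nonempty W := ⟨0⟩
  have hmap : (uniformCoset W v₀).map F
      = (PMF.uniformOfFintype W).map fun w : W => F (v₀ + (w : BV n)) := by
    have hbind : uniformCoset W v₀ = ((PMF.uniformOfFintype W).map Subtype.val).map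
        fun x : BV n => v₀ + x := by
      unfold uniformCoset
      congr 1
      change PMF.bind _ _ = PMF.bind _ _
      congr!
    rw [hbind, PMF.map_comp, PMF.map_comp]
    rfl
  rw [hmap, PMF.map_apply, tsum_fintype, ENNReal.toReal_sum, Finset.sum_div]
  · refine Finset.sum_congr rfl fun w _ => ?_
    by_cases h : F (v₀ + w) = y
    · simp [h]
    · simp [h, Ne.symm h]
  · intro w _
    split_ifs
    · exact PMF.apply_ne_top _ _
    · simp

lemma prodPMF_apply {α β : Type*} [Fintype α] [Fintype β] (p : PMF α) (q : PMF β) (a : α)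
    (b : β) : prodPMF p q (a, b) = p a * q b := by
  classical
  unfold prodPMF
  rw [PMF.bind_apply, tsum_fintype, Finset.sum_eq_single a]
  · rw [PMF.map_apply, tsum_fintype, Finset.sum_eq_single b]
    · simp
    · intro b' _ hb
      simp [Ne.symm hb]
    · simp
  · intro a' _ ha
    rw [PMF.map_apply, tsum_fintype, Finset.sum_eq_zero, mul_zero]
    intro b' _
    simp [Ne.symm ha]
  · simp

/-- The advantage of a test is the average of its bias over the source. -/
lemma sum_sub_sum_eq_testBias {n m : ℕ} (W : Submodule (ZMod 2) (BV n)) (v₀ : BV n) [Fintype W]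
    (g : BV n → Bits m) (f : BV n → BV n) (T : Finset (Bits m × Bits m)) :
    ∑ y ∈ T, (((uniformCoset W v₀).map fun x => (g x, g (f x))) y).toReal
      - ∑ y ∈ T, ((prodPMF (PMF.uniformOfFintype (Bits m))
          ((uniformCoset W v₀).map fun x => g (f x))) y).toReal
      = (∑ w : W, testBias T (g (v₀ + w)) (g (f (v₀ + w)))) / Fintype.card W := by
  have h1 : ∑ y ∈ T, (((uniformCoset W v₀).map fun x => (g x, g (f x))) y).toReal
      = (∑ w : W, if (g (v₀ + w), g (f (v₀ + w))) ∈ T then (1 : ℝ) else 0)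
        / Fintype.card W := by
    simp only [toReal_map_uniformCoset]
    rw [← Finset.sum_div, Finset.sum_comm]
    simp
  have h2 : ∑ y ∈ T, ((prodPMF (PMF.uniformOfFintype (Bits m))
          ((uniformCoset W v₀).map fun x => g (f x))) y).toReal
      = (∑ w : W, (∑ u', if (u', g (f (v₀ + w))) ∈ T then (1 : ℝ) else 0)
          / Fintype.card (Bits m)) / Fintype.card W := by
    have h3 : ∀ y : Bits m × Bits m, ((prodPMF (PMF.uniformOfFintype (Bits m))
          ((uniformCoset W v₀).map fun x => g (f x))) y).toReal
        = (∑ w : W, if g (f (v₀ + w)) = y.2 then (1 : ℝ) else 0)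
          / Fintype.card (Bits m) / Fintype.card W := by
      rintro ⟨a, b⟩
      rw [prodPMF_apply, ENNReal.toReal_mul, toReal_map_uniformCoset,
        PMF.uniformOfFintype_apply, ENNReal.toReal_inv, ENNReal.toReal_natCast]
      ring
    simp only [h3]
    rw [← Finset.sum_div, ← Finset.sum_div, ← Finset.sum_div, Finset.sum_comm]
    congr 2
    refine Finset.sum_congr rfl fun w _ => ?_
    rw [← Finset.sum_filter, ← Finset.sum_filter]
    simp only [Finset.sum_const, nsmul_eq_mul, mul_one]
    congr 1
    refine Finset.card_bij (fun y _ => y.1) ?_ ?_ ?_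
    · rintro ⟨a, b⟩ h
      obtain ⟨hT, rfl⟩ := by simpa using h
      simpa using hT
    · rintro ⟨a, b⟩ h ⟨a', b'⟩ h' haa
      simp only [Finset.mem_filter] at h h'
      exact Prod.ext haa (h.2.symm.trans h'.2)
    · intro a ha
      exact ⟨(a, g (f (v₀ + w))), by simpa using ha, rfl⟩
  rw [h1, h2, ← sub_div, ← Finset.sum_sub_distrib]
  rfl

/-- A fixed-point-free affine map is a proper colouring move for some two-colouring. -/
lemma exists_coloring_of_forall_ne {V : Type*} [AddCommGroup V] [Module (ZMod 2) V]
    (M : V →ₗ[ZMod 2] V) (v : V) (h : ∀ x, M x + v ≠ x) :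
    ∃ c : V → ZMod 2, ∀ x, c (M x + v) ≠ c x := by
  have hv : v ∉ LinearMap.range (LinearMap.id - M) := by
    rintro ⟨x, hx⟩
    refine h x ?_
    rw [← hx]
    simp
  obtain ⟨l, hl, hker⟩ := Submodule.exists_le_ker_of_notMem hv
  refine ⟨l, fun x hx => hl ?_⟩
  have h1 : l x - l (M x) = 0 := by
    simpa using hker (LinearMap.mem_range_self (LinearMap.id - M) x)
  rw [map_add, ← sub_eq_zero.mp h1] at hx
  simpa using hx

lemma exists_matrix_range_eq {n : ℕ} (W : Submodule (ZMod 2) (BV n)) :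
    ∃ A : Matrix (Fin n) (Fin n) (ZMod 2), LinearMap.range (Matrix.toLin' A) = W := by
  obtain ⟨p, hp⟩ := W.subtype.exists_leftInverse_of_injective W.ker_subtype
  refine ⟨LinearMap.toMatrix' (W.subtype ∘ₗ p), ?_⟩
  rw [Matrix.toLin'_toMatrix', LinearMap.range_comp, LinearMap.range_eq_top.mpr,
    Submodule.map_top, Submodule.range_subtype]
  intro w
  exact ⟨w, by simpa using LinearMap.congr_fun hp w⟩

/-- The index type for half-sources together with tampering maps. -/
abbrev AffineData (n : ℕ) : Type :=
  (Matrix (Fin n) (Fin n) (ZMod 2) × BV n) × (Matrix (Fin n) (Fin n) (ZMod 2) × BV n) × ZMod 2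

lemma card_affineData (n : ℕ) : Fintype.card (AffineData n) = 2 ^ (2 * (n * n + n) + 1) := by
  have h1 : Fintype.card (Matrix (Fin n) (Fin n) (ZMod 2)) = 2 ^ (n * n) := by
    rw [← Nat.card_eq_fintype_card]
    simp [Matrix, pow_mul]
  have h2 : Fintype.card (BV n) = 2 ^ n := by simp
  rw [Fintype.card_prod, Fintype.card_prod, Fintype.card_prod, Fintype.card_prod, h1, h2, ZMod.card]
  ring

/-- One function fools every affine source and every fixed-point-free affine tampering. -/
lemma exists_forall_sum_coset_testBias_le (n m : ℕ) {t : ℝ} (ht : 0 < t) :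
    ∃ g : BV n → Bits m, ∀ (W : Submodule (ZMod 2) (BV n)) [Fintype W] (v₀ : BV n)
      (M : BV n →ₗ[ZMod 2] BV n) (v : BV n), (∀ x, M x + v ≠ x) →
      ∀ T : Finset (Bits m × Bits m),
        ∑ w : W, testBias T (g (v₀ + w)) (g (M (v₀ + w) + v)) ≤
          2 * (Real.log (Fintype.card (AffineData n)
            * Fintype.card (Finset (Bits m × Bits m))) / t) + t * Fintype.card W / 2 := by
  classical
  have hcol : ∀ (M : Matrix (Fin n) (Fin n) (ZMod 2)) (v : BV n), ∃ c : BV n → ZMod 2,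
      (∀ x, Matrix.toLin' M x + v ≠ x) → ∀ x, c (Matrix.toLin' M x + v) ≠ c x := by
    intro M v
    by_cases h : ∀ x, Matrix.toLin' M x + v ≠ x
    · obtain ⟨c, hc⟩ := exists_coloring_of_forall_ne _ v h
      exact ⟨c, fun _ => hc⟩
    · exact ⟨0, fun h' => absurd h' h⟩
  choose c hc using hcol
  let C : AffineData n → Finset (BV n) := fun i => Finset.univ.filter fun x =>
    x - i.1.2 ∈ LinearMap.range (Matrix.toLin' i.1.1) ∧
      c i.2.1.1 i.2.1.2 x = i.2.2 ∧ ∀ x, Matrix.toLin' i.2.1.1 x + i.2.1.2 ≠ x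
  obtain ⟨g, hg⟩ := exists_forall_sum_testBias_le (U := Bits m) C
    (fun i x => Matrix.toLin' i.2.1.1 x + i.2.1.2) (by
      intro i x hx hfx
      simp only [C, Finset.mem_filter, Finset.mem_univ, true_and] at hx hfx
      exact hc _ _ hx.2.2 x (hfx.2.1.trans hx.2.1.symm)) ht
  refine ⟨g, fun W _ v₀ M v hM T => ?_⟩
  obtain ⟨A, rfl⟩ := exists_matrix_range_eq W
  obtain ⟨M, rfl⟩ := Matrix.toLin'.surjective M
  have hfib : ∀ F : BV n → ℝ, ∑ w : LinearMap.range (Matrix.toLin' A), F (v₀ + w)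
      = ∑ x ∈ C ((A, v₀), (M, v), 0), F x + ∑ x ∈ C ((A, v₀), (M, v), 1), F x := by
    intro F
    have h1 : ∑ w : LinearMap.range (Matrix.toLin' A), F (v₀ + w)
        = ∑ x ∈ Finset.univ.filter (fun x => x - v₀ ∈ LinearMap.range (Matrix.toLin' A)),
            F x := by
      refine Finset.sum_bij (fun w _ => v₀ + (w : BV n)) ?_ ?_ ?_ ?_
      · intro w _
        rw [Finset.mem_filter, add_sub_cancel_left]
        exact ⟨Finset.mem_univ _, w.2⟩
      · intro w _ w' _ h
        exact Subtype.ext (add_left_cancel h)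
      · intro x hx
        exact ⟨⟨x - v₀, (Finset.mem_filter.mp hx).2⟩, Finset.mem_univ _, by simp⟩
      · intro w _
        rfl
    have h2 : ∀ i : ZMod 2, C ((A, v₀), (M, v), i) = (Finset.univ.filter
        (fun x => x - v₀ ∈ LinearMap.range (Matrix.toLin' A))).filter (fun x => c M v x = i) := by
      intro i
      ext x
      simp only [C, Finset.mem_filter, Finset.mem_univ, true_and]
      exact ⟨fun h => ⟨h.1, h.2.1⟩, fun h => ⟨h.1, h.2, hM⟩⟩
    rw [h1, h2, h2, ← Finset.sum_fiberwise _ (c M v) F]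
    exact Fin.sum_univ_two _
  have hcard := hfib fun _ => 1
  simp only [Finset.sum_const, nsmul_eq_mul, mul_one, Finset.card_univ] at hcard
  rw [hfib fun x => testBias T (g x) (g (Matrix.toLin' M x + v)), hcard]
  have h0 := hg ((A, v₀), (M, v), 0) T
  have h1 := hg ((A, v₀), (M, v), 1) T
  linarith

lemma log_card_le (n m : ℕ) :
    Real.log (Fintype.card (AffineData n) * Fintype.card (Finset (Bits m × Bits m)))
      ≤ 2 * ((n : ℝ) * n + n) + 1 + (2 ^ m) ^ 2 := by
  have h : (Fintype.card (AffineData n) : ℝ) * Fintype.card (Finset (Bits m × Bits m))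
      = 2 ^ (2 * (n * n + n) + 1 + (2 ^ m) ^ 2) := by
    rw [card_affineData, Fintype.card_finset]
    simp only [Fintype.card_prod, Fintype.card_fun, Fintype.card_bool, Fintype.card_fin]
    push_cast
    rw [← pow_add, sq]
  rw [h, Real.log_pow]
  push_cast
  have h2 : Real.log 2 ≤ 1 := by linarith [Real.log_two_lt_d9]
  have h3 : (0 : ℝ) ≤ 2 * ((n : ℝ) * n + n) + 1 + (2 ^ m) ^ 2 := by positivity
  nlinarith

/-- The numerical inequality behind the union bound, in terms of `s = n / 64` and `Y = 2 ^ s`. -/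
lemma union_bound_numeric {s Y : ℝ} (hs : 1 ≤ s) (hsY : s ≤ Y) (hY : 2 ≤ Y) :
    4 * (2 * ((64 * s) * (64 * s) + 64 * s) + 1 + Y ^ 4) ≤ Y ^ 30 := by
  have h1 : s * s ≤ Y * Y := mul_self_le_mul_self (by linarith) hsY
  have h2 : 4 ≤ Y * Y := by nlinarith
  have h3 : 4 * (Y * Y) ≤ Y ^ 4 := by nlinarith
  have h5 : (2 : ℝ) ^ 14 ≤ Y ^ 14 := pow_le_pow_left₀ (by norm_num) hY 14
  have h6 : Y ^ 18 ≤ Y ^ 30 := pow_le_pow_right₀ (by linarith) (by norm_num)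
  have h7 : Y ^ 18 = Y ^ 14 * Y ^ 4 := by ring
  have h8 : 2 ^ 14 * Y ^ 4 ≤ Y ^ 14 * Y ^ 4 := by gcongr
  nlinarith

lemma sd_le_of_forall_testBias {n m : ℕ} (W : Submodule (ZMod 2) (BV n)) [Fintype W]
    (v₀ : BV n) (g : BV n → Bits m) (f : BV n → BV n) {ε : ℝ}
    (h : ∀ T, ∑ w : W, testBias T (g (v₀ + w)) (g (f (v₀ + w))) ≤ ε * Fintype.card W) :
    sd ((uniformCoset W v₀).map fun x => (g x, g (f x)))
      (prodPMF (PMF.uniformOfFintype (Bits m)) ((uniformCoset W v₀).map fun x => g (f x)))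
      ≤ ε := by
  have hW : (0 : ℝ) < Fintype.card W := by
    exact_mod_cast Fintype.card_pos_iff.mpr ⟨(0 : W)⟩
  refine ciSup_le fun T => ?_
  rw [sum_sub_sum_eq_testBias W v₀ g f T, abs_le, le_div_iff₀ hW, div_le_iff₀ hW]
  refine ⟨?_, h T⟩
  have hT := h Tᶜ
  simp only [testBias_compl, Finset.sum_neg_distrib] at hT
  linarith

lemma testBias_bits_one_le (T : Finset (Bits 1 × Bits 1)) (u w : Bits 1) :
    testBias T u w ≤ 1 / 2 := by
  unfold testBias
  have h2 : (Fintype.card (Bits 1) : ℝ) = 2 := by simp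
  have h3 : (if (u, w) ∈ T then (1 : ℝ) else 0) ≤ ∑ u', if (u', w) ∈ T then (1 : ℝ) else 0 :=
    Finset.single_le_sum (f := fun u' => if (u', w) ∈ T then (1 : ℝ) else 0)
      (fun _ _ => by split_ifs <;> norm_num) (Finset.mem_univ u)
  have h4 : (if (u, w) ∈ T then (1 : ℝ) else 0) ≤ 1 := by split_ifs <;> norm_num
  rw [h2]
  linarith

/-- There exist constants `0 < γ < 1` and `α > 0` such that for every `n` there is a
`((1-γ)n, 2^{-αn})` affine non-malleable extractor with output length `m ≥ α n`: for
every affine source `X` (uniform over a coset `v₀ + W` with `dim W ≥ (1-γ)n`) and every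
affine function `f(x) = Mx + v` with no fixed points,
`Δ((anmExt(X), anmExt(f(X))), (U_m, anmExt(f(X)))) ≤ 2^{-αn}`. -/
theorem stmt_10 :
    ∃ γ : ℝ, 0 < γ ∧ γ < 1 ∧
      ∃ α : ℝ, α > 0 ∧
        ∀ n : ℕ,
          ∃ m : ℕ, (m : ℝ) ≥ α * n ∧
            ∃ anmExt : BV n → Bits m,
              ∀ (W : Submodule (ZMod 2) (BV n)) (v₀ : BV n),
                (Module.finrank (ZMod 2) W : ℝ) ≥ (1 - γ) * n →
                ∀ (M : BV n →ₗ[ZMod 2] BV n) (v : BV n),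
                  (∀ x, M x + v ≠ x) →
                  sd ((uniformCoset W v₀).map fun x => (anmExt x, anmExt (M x + v)))
                     (prodPMF (PMF.uniformOfFintype (Bits m))
                       ((uniformCoset W v₀).map fun x => anmExt (M x + v)))
                    ≤ (2 : ℝ) ^ (-(α * n)) := by
  refine ⟨1 / 2, by norm_num, by norm_num, 1 / 64, by norm_num, fun n => ?_⟩
  rcases le_or_gt n 64 with hn | hn
  · have hn' : (n : ℝ) ≤ 64 := by exact_mod_cast hn
    refine ⟨1, by push_cast; linarith, fun _ => 0, fun W v₀ _ M v _ => ?_⟩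
    have : Fintype W := Fintype.ofFinite W
    have h : (1 / 2 : ℝ) ≤ 2 ^ (-(1 / 64 * (n : ℝ))) := by
      rw [one_div, ← Real.rpow_neg_one]
      exact Real.rpow_le_rpow_of_exponent_le (by norm_num) (by linarith)
    refine (sd_le_of_forall_testBias W v₀ (fun _ => 0) (fun x => M x + v) fun T => ?_).trans h
    calc _ ≤ ∑ _w : W, (1 / 2 : ℝ) := Finset.sum_le_sum fun _ _ => testBias_bits_one_le T _ _
      _ = _ := by simp [mul_comm]
  · have hn' : (64 : ℝ) < n := by exact_mod_cast hn
    obtain ⟨s, hs⟩ : ∃ s : ℝ, (n : ℝ) = 64 * s := ⟨n / 64, by ring⟩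
    have hs1 : 1 ≤ s := by linarith
    set Y : ℝ := 2 ^ s with hYdef
    have hY2 : 2 ≤ Y := by
      simpa using Real.rpow_le_rpow_of_exponent_le (x := 2) (by norm_num) hs1
    have hY0 : 0 < Y := by linarith
    have hsY : s ≤ Y := by
      have := one_add_mul_self_le_rpow_one_add (s := 1) (by norm_num) hs1
      norm_num at this
      linarith
    have hε : (2 : ℝ) ^ (-(1 / 64 * (n : ℝ))) = Y⁻¹ := by
      rw [hs, ← Real.rpow_neg (by norm_num)]
      congr 1
      ring
    have hm : (2 : ℝ) ^ ⌈s⌉₊ ≤ Y ^ 2 := by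
      have h1 : (⌈s⌉₊ : ℝ) ≤ s * 2 := by linarith [Nat.ceil_lt_add_one (by linarith : 0 ≤ s)]
      calc (2 : ℝ) ^ ⌈s⌉₊ = 2 ^ (⌈s⌉₊ : ℝ) := (Real.rpow_natCast _ _).symm
        _ ≤ 2 ^ (s * 2) := Real.rpow_le_rpow_of_exponent_le (by norm_num) h1
        _ = Y ^ 2 := by rw [Real.rpow_mul (by norm_num)]; norm_num [hYdef]
    obtain ⟨g, hg⟩ := exists_forall_sum_coset_testBias_le n ⌈s⌉₊ (inv_pos.mpr hY0)
    refine ⟨⌈s⌉₊, by rw [hs]; linarith [Nat.le_ceil s], g, fun W v₀ hW M v hM => ?_⟩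
    have : Fintype W := Fintype.ofFinite W
    rw [hε]
    refine sd_le_of_forall_testBias W v₀ g (fun x => M x + v) fun T =>
      (hg W v₀ M v hM T).trans ?_
    have hK : Y ^ 32 ≤ Fintype.card W := by
      rw [Module.card_eq_pow_finrank (K := ZMod 2) (V := W), ZMod.card]
      push_cast
      calc Y ^ 32 = 2 ^ (s * 32) := by rw [Real.rpow_mul (by norm_num)]; norm_num [hYdef]
        _ ≤ 2 ^ (Module.finrank (ZMod 2) W : ℝ) :=
          Real.rpow_le_rpow_of_exponent_le (by norm_num) (by linarith)
        _ = _ := Real.rpow_natCast _ _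
    have hL := log_card_le n ⌈s⌉₊
    set L := Real.log (Fintype.card (AffineData n)
      * Fintype.card (Finset (Bits ⌈s⌉₊ × Bits ⌈s⌉₊)))
    have hm2 : ((2 : ℝ) ^ ⌈s⌉₊) ^ 2 ≤ Y ^ 4 := by
      calc ((2 : ℝ) ^ ⌈s⌉₊) ^ 2 ≤ (Y ^ 2) ^ 2 := by gcongr
        _ = Y ^ 4 := by ring
    have hnum := union_bound_numeric hs1 hsY hY2
    have hL' : 4 * L ≤ Y ^ 30 := by
      rw [hs] at hL
      linarith
    have hmain : 4 * L * Y ^ 2 ≤ Fintype.card W := by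
      calc 4 * L * Y ^ 2 ≤ Y ^ 30 * Y ^ 2 := by gcongr
        _ = Y ^ 32 := by ring
        _ ≤ _ := hK
    have hLY : L / Y⁻¹ = L * Y ^ 2 * Y⁻¹ := by field_simp
    rw [hLY]
    have := mul_le_mul_of_nonneg_right hmain (inv_pos.mpr hY0).le
    linarith
end
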